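/- If a commutative semigroup variety V with V ≠ COM is an upper-modular element of the lattice Com, then the lattice L(V) of all subvarieties of V is distributive. -/

import Mathlib

/-!
Formalization framework: semigroup varieties as Galois-closed equational theories
over the free semigroup on countably many letters.  A variety is represented by
its equational theory; the order `V ≤ W` ("V is a subvariety of W") is reverse
inclusion of theories.  `Com` is the lattice of commutative semigroup varieties,
realized as the subtype of varieties whose theory contains the commutative law.
-/

open FreeSemigroup

/-- Words: elements of the free semigroup over a countably infinite alphabet. -/
abbrev Word : Type := FreeSemigroup ℕ

/-- A semigroup identity `u = v`. -/
abbrev SgId : Type := Word × Word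

/-- `spow a n = a ^ (n + 1)` in any (multiplicative) semigroup. -/
def spow {M : Type*} [Mul M] (a : M) : ℕ → M
  | 0 => a
  | n + 1 => a * spow a n

/-- A semigroup `S` satisfies the identity `e.1 = e.2`. -/
def SatS (S : Type) [Semigroup S] (e : SgId) : Prop :=
  ∀ σ : ℕ → S, FreeSemigroup.lift σ e.1 = FreeSemigroup.lift σ e.2

/-- `S` is a model of the set of identities `E`. -/
def Models (S : Type) [Semigroup S] (E : Set SgId) : Prop :=
  ∀ e ∈ E, SatS S e

/-- The equational theory generated by `E`: all identities holding in every
model of `E` (by Birkhoff's theorem this is exactly deductive closure). -/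
def eqTh (E : Set SgId) : Set SgId :=
  { e | ∀ (S : Type) [Semigroup S], Models S E → SatS S e }

theorem subset_eqTh (E : Set SgId) : E ⊆ eqTh E := by
  intro e he S _ hS
  exact hS e he

theorem eqTh_mono {E F : Set SgId} (h : E ⊆ F) : eqTh E ⊆ eqTh F := by
  intro e he S _ hS
  exact he S fun e' he' => hS e' (h he')

theorem eqTh_idem (E : Set SgId) : eqTh (eqTh E) = eqTh E := by
  refine Set.Subset.antisymm ?_ (subset_eqTh _)
  intro e he S _ hS
  exact he S fun e' he' => he' S hS

/-- A semigroup variety, given by its (Galois-closed) equational theory. -/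
structure SgVariety where
  th : Set SgId
  closed : eqTh th = th

theorem SgVariety.ext' {V W : SgVariety} (h : V.th = W.th) : V = W := by
  cases V; cases W; cases h; rfl

/-- The variety defined by a set of identities. -/
def varOf (E : Set SgId) : SgVariety :=
  ⟨eqTh E, eqTh_idem E⟩

/-- `V ≤ W` iff `V` is a subvariety of `W`, i.e. the theory of `W` is contained
in the theory of `V`. -/
instance : PartialOrder SgVariety where
  le V W := W.th ⊆ V.th
  le_refl V := Set.Subset.refl _
  le_trans a b c h1 h2 := Set.Subset.trans h2 h1
  le_antisymm a b h1 h2 := SgVariety.ext' (Set.Subset.antisymm h2 h1)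

/-- The lattice **SEM** of all semigroup varieties: join is intersection of
theories; meet is the variety defined by the union of the theories. -/
instance : Lattice SgVariety :=
  { (inferInstance : PartialOrder SgVariety) with
    sup := fun V W =>
      ⟨V.th ∩ W.th, by
        refine Set.Subset.antisymm (Set.subset_inter ?_ ?_) (subset_eqTh _)
        · exact (eqTh_mono Set.inter_subset_left).trans (le_of_eq V.closed)
        · exact (eqTh_mono Set.inter_subset_right).trans (le_of_eq W.closed)⟩
    le_sup_left := fun V W => Set.inter_subset_left
    le_sup_right := fun V W => Set.inter_subset_right
    sup_le := fun V W U h1 h2 => Set.subset_inter h1 h2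
    inf := fun V W => varOf (V.th ∪ W.th)
    inf_le_left := fun V W => Set.subset_union_left.trans (subset_eqTh _)
    inf_le_right := fun V W => Set.subset_union_right.trans (subset_eqTh _)
    le_inf := fun U V W h1 h2 =>
      (eqTh_mono (Set.union_subset h1 h2)).trans (le_of_eq U.closed) }

/-- The letters `x`, `y`, `z`. -/
def xw : Word := FreeSemigroup.of 0
def yw : Word := FreeSemigroup.of 1
def zw : Word := FreeSemigroup.of 2

/-- The commutative law `xy = yx`. -/
def commId : SgId := (xw * yw, yw * xw)

/-- The lattice **Com**: commutative semigroup varieties. -/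
abbrev ComVariety : Type := { V : SgVariety // commId ∈ V.th }

instance : Lattice ComVariety :=
  { (inferInstance : PartialOrder ComVariety) with
    sup := fun V W => ⟨V.1 ⊔ W.1, ⟨V.2, W.2⟩⟩
    le_sup_left := fun V W => @le_sup_left SgVariety _ V.1 W.1
    le_sup_right := fun V W => @le_sup_right SgVariety _ V.1 W.1
    sup_le := fun V W U h1 h2 => @sup_le SgVariety _ V.1 W.1 U.1 h1 h2
    inf := fun V W => ⟨V.1 ⊓ W.1, subset_eqTh _ (Set.mem_union_left _ V.2)⟩
    inf_le_left := fun V W => @inf_le_left SgVariety _ V.1 W.1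
    inf_le_right := fun V W => @inf_le_right SgVariety _ V.1 W.1
    le_inf := fun U V W h1 h2 => @le_inf SgVariety _ U.1 V.1 W.1 h1 h2 }

/-- The trivial variety `T`. -/
def trivialVar : SgVariety := varOf Set.univ

/-- The variety `COM` of all commutative semigroups. -/
def COMvar : SgVariety := varOf {commId}

/-- The variety `SL` of semilattices. -/
def SLvar : SgVariety := varOf {commId, (xw * xw, xw)}

/-- `C_m = var{xᵐ = xᵐ⁺¹, xy = yx}` for `m ≥ 1`, and `C_0 = T`. -/
def Cvar : ℕ → SgVariety
  | 0 => trivialVar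
  | m + 1 => varOf {commId, (spow xw m, spow xw (m + 1))}

def Tcom : ComVariety := ⟨trivialVar, subset_eqTh _ (Set.mem_univ _)⟩
def COMcom : ComVariety := ⟨COMvar, subset_eqTh _ rfl⟩
def SLcom : ComVariety := ⟨SLvar, subset_eqTh _ (Set.mem_insert _ _)⟩
def Ccom (m : ℕ) : ComVariety :=
  ⟨Cvar m, by
    cases m with
    | zero => exact subset_eqTh _ (Set.mem_univ _)
    | succ m => exact subset_eqTh _ (Set.mem_insert _ _)⟩

/-- A semigroup (nonempty, with the given multiplication) is a group. -/
def IsGroupS (S : Type) [Semigroup S] : Prop :=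
  ∃ e : S, (∀ a : S, e * a = a ∧ a * e = a) ∧ ∀ a : S, ∃ b : S, a * b = e ∧ b * a = e

/-- A nilsemigroup: there is a zero element and some power of every element is zero. -/
def IsNilS (S : Type) [Semigroup S] : Prop :=
  ∃ z : S, (∀ a : S, z * a = z ∧ a * z = z) ∧ ∀ a : S, ∃ n : ℕ, spow a n = z

/-- A group variety: all its (nonempty) members are groups. -/
def IsGroupVariety (V : SgVariety) : Prop :=
  ∀ (S : Type) [Semigroup S], Nonempty S → Models S V.th → IsGroupS S

/-- A nil-variety: all its (nonempty) members are nilsemigroups. -/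
def IsNilVariety (V : SgVariety) : Prop :=
  ∀ (S : Type) [Semigroup S], Nonempty S → Models S V.th → IsNilS S

/-- A combinatorial variety: all groups in it are singletons. -/
def IsCombinatorial (V : SgVariety) : Prop :=
  ∀ (S : Type) [Semigroup S], Models S V.th → IsGroupS S → Subsingleton S

/-- A periodic variety: satisfies `xⁿ = xⁿ⁺ᵏ` for some `n, k ≥ 1`. -/
def IsPeriodic (V : SgVariety) : Prop :=
  ∃ n k : ℕ, (spow xw n, spow xw (n + k + 1)) ∈ V.th

/-- The letter `k` occurs in the word `w`. -/
def occursIn (k : ℕ) (w : Word) : Prop := k = w.head ∨ k ∈ w.tail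

/-- `S` satisfies the identity `w = 0` (i.e. the system `wx = xw = w`, `x` fresh):
every value of `w` in `S` is a (two-sided) zero element. -/
def SatZeroS (S : Type) [Semigroup S] (w : Word) : Prop :=
  ∀ (σ : ℕ → S) (a : S),
    FreeSemigroup.lift σ w * a = FreeSemigroup.lift σ w ∧
      a * FreeSemigroup.lift σ w = FreeSemigroup.lift σ w

/-- The variety `V` satisfies the identity `w = 0`. -/
def VSatZero (V : SgVariety) (w : Word) : Prop :=
  ∀ (S : Type) [Semigroup S], Models S V.th → SatZeroS S w

/-- The words `x²`, `x³`, `x²y`, `xy²`, `x²yz`. -/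
def w_xx : Word := xw * xw
def w_xxx : Word := xw * xw * xw
def w_xxy : Word := xw * xw * yw
def w_xyy : Word := xw * yw * yw
def w_xxyz : Word := xw * xw * yw * zw

/-- The identity `x²y = xy²`. -/
def idQ : SgId := (w_xxy, w_xyy)

/-- The pair of identities expressing `w = 0`, with `k` a fresh letter. -/
def zeroPair (w : Word) (k : ℕ) : Set SgId :=
  {(w * FreeSemigroup.of k, w), (FreeSemigroup.of k * w, w)}

/-- `xprodTo n = x₁x₂⋯xₙ` (for `n ≥ 1`), on the letters `0, …, n-1`. -/
def xprodTo : ℕ → Word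
  | 0 => FreeSemigroup.of 0
  | 1 => FreeSemigroup.of 0
  | n + 2 => xprodTo (n + 1) * FreeSemigroup.of (n + 1)

/-- `I = var{x²y = xy², x²yz = 0, xy = yx}`. -/
def Ivar : SgVariety := varOf ({commId, idQ} ∪ zeroPair w_xxyz 3)

/-- `K = var{x²y = 0, xy = yx}`. -/
def Kvar : SgVariety := varOf ({commId} ∪ zeroPair w_xxy 2)

/-- `L = var{x² = 0, xy = yx}`. -/
def Lvar : SgVariety := varOf ({commId} ∪ zeroPair w_xx 1)

/-- `I_n = var{x²yz = x₁⋯xₙ = 0, x²y = xy², xy = yx}`. -/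
def Ivarn (n : ℕ) : SgVariety :=
  varOf ({commId, idQ} ∪ zeroPair w_xxyz 3 ∪ zeroPair (xprodTo n) n)

/-- `J = var{x²yz = x³ = 0, x²y = xy², xy = yx}`. -/
def Jvar : SgVariety := varOf ({commId, idQ} ∪ zeroPair w_xxyz 3 ∪ zeroPair w_xxx 1)

/-- `J_n = var{x²yz = x³ = x₁⋯xₙ = 0, x²y = xy², xy = yx}`. -/
def Jvarn (n : ℕ) : SgVariety :=
  varOf ({commId, idQ} ∪ zeroPair w_xxyz 3 ∪ zeroPair w_xxx 1 ∪ zeroPair (xprodTo n) n)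

/-- `K_n = var{x²y = x₁⋯xₙ = 0, xy = yx}`. -/
def Kvarn (n : ℕ) : SgVariety :=
  varOf ({commId} ∪ zeroPair w_xxy 2 ∪ zeroPair (xprodTo n) n)

/-- `L_n = var{x² = x₁⋯xₙ = 0, xy = yx}`. -/
def Lvarn (n : ℕ) : SgVariety :=
  varOf ({commId} ∪ zeroPair w_xx 1 ∪ zeroPair (xprodTo n) n)

/-- Generators of `ZR(U)`: the commutative law together with all 0-reduced
identities (in the form of the corresponding identity pairs) holding in `U`. -/
def ZRgen (U : SgVariety) : Set SgId :=
  {commId} ∪ { e : SgId | ∃ (w : Word) (k : ℕ), ¬ occursIn k w ∧ VSatZero U w ∧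
      (e = (w * FreeSemigroup.of k, w) ∨ e = (FreeSemigroup.of k * w, w)) }

/-- `ZR(U)`: the variety given by the commutative law and all 0-reduced
identities holding in `U`. -/
def ZRvar (U : SgVariety) : SgVariety := varOf (ZRgen U)

def Icom : ComVariety := ⟨Ivar, subset_eqTh _ (Set.mem_union_left _ (Set.mem_insert _ _))⟩

def ZRcom (U : SgVariety) : ComVariety :=
  ⟨ZRvar U, subset_eqTh _ (Set.mem_union_left _ rfl)⟩

/-- All nilsemigroups in `V` are nilpotent of degree ≤ n, i.e. satisfy `x₁⋯xₙ = 0`. -/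
def HasDegLe (V : SgVariety) (n : ℕ) : Prop :=
  ∀ (S : Type) [Semigroup S], Nonempty S → Models S V.th → IsNilS S → SatZeroS S (xprodTo n)

/-- `deg V = d` (with `d = ⊤` meaning infinite degree). -/
def DegIs (V : SgVariety) (d : ℕ∞) : Prop :=
  (∃ n : ℕ, 0 < n ∧ d = (n : ℕ∞) ∧ IsLeast {m : ℕ | 0 < m ∧ HasDegLe V m} n) ∨
    (d = ⊤ ∧ ∀ n : ℕ, 0 < n → ¬ HasDegLe V n)

/-- Upper-modular element of a lattice. -/
def IsUpperModular {L : Type*} [Lattice L] (a : L) : Prop :=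
  ∀ b c : L, b ≤ a → a ⊓ (b ⊔ c) = b ⊔ (a ⊓ c)

/-- Codistributive element of a lattice. -/
def IsCodistributive {L : Type*} [Lattice L] (a : L) : Prop :=
  ∀ b c : L, a ⊓ (b ⊔ c) = (a ⊓ b) ⊔ (a ⊓ c)

/-- Costandard element of a lattice. -/
def IsCostandard {L : Type*} [Lattice L] (a : L) : Prop :=
  ∀ b c : L, (a ⊓ b) ⊔ c = (a ⊔ c) ⊓ (b ⊔ c)

/-- Modular element of a lattice. -/
def IsModularElt {L : Type*} [Lattice L] (a : L) : Prop :=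
  ∀ b c : L, b ≤ c → (a ⊔ b) ⊓ c = (a ⊓ c) ⊔ b

/-- Neutral element of a lattice, via the median characterization
(equivalent to: every triple containing `a` generates a distributive
sublattice; Grätzer, "Lattice Theory: Foundation", Theorem 254). -/
def IsNeutralElt {L : Type*} [Lattice L] (a : L) : Prop :=
  ∀ b c : L, (a ⊓ b) ⊔ (b ⊓ c) ⊔ (c ⊓ a) = (a ⊔ b) ⊓ (b ⊔ c) ⊓ (c ⊔ a)

/-- Commutative words, as exponent vectors (the empty word included). -/
abbrev Expo : Type := ℕ →₀ ℕ

/-- The exponent vector of a word. -/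
noncomputable def expo (w : Word) : Expo :=
  Multiplicative.toAdd
    (FreeSemigroup.lift (fun i => Multiplicative.ofAdd (Finsupp.single i 1 : Expo)) w)

@[simp]
theorem expo_of (i : ℕ) : expo (FreeSemigroup.of i) = Finsupp.single i 1 := rfl

@[simp]
theorem expo_mul (a b : Word) : expo (a * b) = expo a + expo b := by
  simp [expo, map_mul]

theorem expo_ne_zero (w : Word) : expo w ≠ 0 := by
  induction w using FreeSemigroup.recOnMul with
  | ih1 i => simp
  | ih2 i w _ ih => simp

theorem exists_expo_eq {u : Expo} (hu : u ≠ 0) : ∃ w : Word, expo w = u := by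
  have key : ∀ u : Expo, u = 0 ∨ ∃ w : Word, expo w = u := by
    intro u
    induction u using Finsupp.induction_linear with
    | zero => exact Or.inl rfl
    | add f g hf hg =>
      rcases hf with rfl | ⟨a, rfl⟩
      · simpa using hg
      rcases hg with rfl | ⟨b, rfl⟩
      · exact Or.inr ⟨a, by simp⟩
      · exact Or.inr ⟨a * b, by simp⟩
    | single i n =>
      induction n with
      | zero => simp
      | succ n ih =>
        right
        rcases ih with h | ⟨a, ha⟩
        · exact ⟨FreeSemigroup.of i, by rw [Finsupp.single_add, h]; simp⟩
        · exact ⟨a * FreeSemigroup.of i, by rw [Finsupp.single_add, ← ha]; simp⟩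
  exact (key u).resolve_left hu

/-- Substitution of the commutative words `φ i` for the letters `i`. -/
noncomputable def subst (φ : ℕ → Expo) : Expo →ₗ[ℕ] Expo := Finsupp.linearCombination ℕ φ

@[simp]
theorem subst_single (φ : ℕ → Expo) (i n : ℕ) : subst φ (Finsupp.single i n) = n • φ i := by
  simp [subst]

theorem expo_lift (τ : ℕ → Word) (w : Word) :
    expo (FreeSemigroup.lift τ w) = subst (fun i => expo (τ i)) (expo w) := by
  induction w using FreeSemigroup.recOnMul with
  | ih1 i => simp
  | ih2 i w _ ih => simp [map_mul, ih]

theorem subst_letters (u : Expo) : subst (fun i => Finsupp.single i 1) u = u := by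
  induction u using Finsupp.induction_linear with
  | zero => simp
  | add f g hf hg => simp [hf, hg]
  | single i n => simp

/-- Fully invariant congruences on the free commutative semigroup. -/
structure FullyInvariant (r : Expo → Expo → Prop) : Prop where
  refl : ∀ u, r u u
  symm : ∀ {u v}, r u v → r v u
  trans : ∀ {u v w}, r u v → r v w → r u w
  add : ∀ {u v} (k), r u v → r (u + k) (v + k)
  map : ∀ {u v} (φ : ℕ → Expo), (∀ i, φ i ≠ 0) → r u v → r (subst φ u) (subst φ v)
  ne_zero : ∀ {u v}, r u v → u ≠ 0 → v ≠ 0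

theorem mem_th_iff (V : SgVariety) (e : SgId) :
    e ∈ V.th ↔ ∀ (S : Type) [Semigroup S], Models S V.th → SatS S e := by
  conv_lhs => rw [← V.closed]
  rfl

theorem lift_lift {S : Type} [Semigroup S] (σ : ℕ → S) (τ : ℕ → Word) (w : Word) :
    FreeSemigroup.lift σ (FreeSemigroup.lift τ w) =
      FreeSemigroup.lift (fun i => FreeSemigroup.lift σ (τ i)) w := by
  induction w using FreeSemigroup.recOnMul with
  | ih1 i => simp
  | ih2 i w _ ih => simp [map_mul, ih]

/-- In a commutative semigroup the value of a word depends only on its exponent vector. -/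
theorem lift_eq_of_expo_eq {S : Type} [Semigroup S] (hS : ∀ a b : S, a * b = b * a)
    (σ : ℕ → S) {a b : Word} (h : expo a = expo b) :
    FreeSemigroup.lift σ a = FreeSemigroup.lift σ b := by
  let _ : CommSemigroup S := { (inferInstance : Semigroup S) with mul_comm := hS }
  have key : ∀ w : Word, ((FreeSemigroup.lift σ w : S) : WithOne S) =
      (expo w).prod fun i n => (σ i : WithOne S) ^ n := by
    intro w
    induction w using FreeSemigroup.recOnMul with
    | ih1 i => simp
    | ih2 i w _ ih =>
      rw [map_mul, WithOne.coe_mul, ih, expo_mul, Finsupp.prod_add_index' (by simp)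
        (by intros; rw [pow_add])]
      simp
  have := key a
  rw [h, ← key b] at this
  exact WithOne.coe_injective this

theorem mul_comm_of_models {V : ComVariety} {S : Type} [Semigroup S] (hS : Models S V.1.th)
    (a b : S) : a * b = b * a := by
  have := hS _ V.2 (fun i => if i = 0 then a else b)
  simpa [commId, xw, yw, map_mul] using this

theorem mem_th_of_expo_eq (V : ComVariety) {a b : Word} (h : expo a = expo b) :
    (a, b) ∈ V.1.th := by
  rw [mem_th_iff]
  intro S _ hS σ
  exact lift_eq_of_expo_eq (mul_comm_of_models hS) σ h

/-- The fully invariant congruence of a commutative variety. -/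
def ComVariety.rel (V : ComVariety) (u v : Expo) : Prop :=
  u = v ∨ ∃ a b : Word, expo a = u ∧ expo b = v ∧ (a, b) ∈ V.1.th

theorem th_symm {V : SgVariety} {a b : Word} (h : (a, b) ∈ V.th) : (b, a) ∈ V.th := by
  rw [mem_th_iff] at h ⊢
  exact fun S _ hS σ => (h S hS σ).symm

theorem th_trans {V : SgVariety} {a b c : Word} (h : (a, b) ∈ V.th) (h' : (b, c) ∈ V.th) :
    (a, c) ∈ V.th := by
  rw [mem_th_iff] at h h' ⊢
  exact fun S _ hS σ => (h S hS σ).trans (h' S hS σ)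

theorem rel_expo_iff (V : ComVariety) (a b : Word) :
    V.rel (expo a) (expo b) ↔ (a, b) ∈ V.1.th := by
  constructor
  · rintro (h | ⟨c, d, hc, hd, h⟩)
    · exact mem_th_of_expo_eq V h
    · exact th_trans (mem_th_of_expo_eq V hc.symm) (th_trans h (mem_th_of_expo_eq V hd))
  · exact fun h => Or.inr ⟨a, b, rfl, rfl, h⟩

theorem ComVariety.rel_fullyInvariant (V : ComVariety) : FullyInvariant V.rel where
  refl u := Or.inl rfl
  symm := by
    rintro u v (rfl | ⟨a, b, rfl, rfl, h⟩)
    · exact Or.inl rfl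
    · exact Or.inr ⟨b, a, rfl, rfl, th_symm h⟩
  trans := by
    rintro u v w (rfl | ⟨a, b, rfl, rfl, h⟩) h'
    · exact h'
    · rcases h' with rfl | ⟨c, d, hc, rfl, h'⟩
      · exact Or.inr ⟨a, b, rfl, rfl, h⟩
      · rw [rel_expo_iff]
        exact th_trans h (th_trans (mem_th_of_expo_eq V hc.symm) h')
  add := by
    rintro u v k (rfl | ⟨a, b, rfl, rfl, h⟩)
    · exact Or.inl rfl
    · rcases eq_or_ne k 0 with rfl | hk
      · exact Or.inr ⟨a, b, by simp, by simp, h⟩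
      · obtain ⟨c, rfl⟩ := exists_expo_eq hk
        rw [← expo_mul, ← expo_mul, rel_expo_iff, mem_th_iff]
        rw [mem_th_iff] at h
        intro S _ hS σ
        have := h S hS σ
        simp only [map_mul] at this ⊢
        rw [this]
  map := by
    rintro u v φ hφ (rfl | ⟨a, b, rfl, rfl, h⟩)
    · exact Or.inl rfl
    · choose τ hτ using fun i => exists_expo_eq (hφ i)
      obtain rfl : (fun i => expo (τ i)) = φ := funext hτ
      rw [← expo_lift, ← expo_lift, rel_expo_iff, mem_th_iff]
      rw [mem_th_iff] at h
      intro S _ hS σ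
      have := h S hS (fun i => FreeSemigroup.lift σ (τ i))
      simpa only [lift_lift] using this
  ne_zero := by
    rintro u v (rfl | ⟨a, b, rfl, rfl, h⟩) hu
    · exact hu
    · exact expo_ne_zero b

/-- An equivalence relation containing all instances of the identities in `E` contains
every consequence of `E`. -/
theorem rel_of_mem_eqTh {E : Set SgId} {r : Expo → Expo → Prop} (hr : Equivalence r)
    (hE : ∀ e ∈ E, ∀ (φ : ℕ → Expo), (∀ i, φ i ≠ 0) → ∀ k : Expo,
      r (subst φ (expo e.1) + k) (subst φ (expo e.2) + k))
    {e : SgId} (he : e ∈ eqTh E) : r (expo e.1) (expo e.2) := by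
  let c : Con Word :=
    { r := fun a b => ∀ (φ : ℕ → Expo), (∀ i, φ i ≠ 0) → ∀ k : Expo,
        r (subst φ (expo a) + k) (subst φ (expo b) + k)
      iseqv := ⟨fun a φ _ k => hr.refl _, fun h φ hφ k => hr.symm (h φ hφ k),
        fun h h' φ hφ k => hr.trans (h φ hφ k) (h' φ hφ k)⟩
      mul' := by
        intro a b a' b' h h' φ hφ k
        have h1 := h φ hφ (subst φ (expo a') + k)
        have h2 := h' φ hφ (subst φ (expo b) + k)
        simp only [expo_mul, map_add]
        have e1 : subst φ (expo a) + subst φ (expo a') + k =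
          subst φ (expo a) + (subst φ (expo a') + k) := by abel
        have e2 : subst φ (expo b) + subst φ (expo b') + k =
          subst φ (expo b') + (subst φ (expo b) + k) := by abel
        have e3 : subst φ (expo b) + (subst φ (expo a') + k) =
          subst φ (expo a') + (subst φ (expo b) + k) := by abel
        rw [e1, e2]
        rw [e3] at h1
        exact hr.trans h1 h2 }
  have lift_mk : ∀ (τ : ℕ → Word) (w : Word),
      FreeSemigroup.lift (fun i => ((τ i : Word) : c.Quotient)) w =
        ((FreeSemigroup.lift τ w : Word) : c.Quotient) := by
    intro τ w
    induction w using FreeSemigroup.recOnMul with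
    | ih1 i => simp
    | ih2 i w _ ih => simp [map_mul, ih]
  have hmod : Models c.Quotient E := by
    intro e he σ
    choose τ hτ using fun i => Quotient.exists_rep (σ i)
    obtain rfl : (fun i => ((τ i : Word) : c.Quotient)) = σ := funext hτ
    rw [lift_mk, lift_mk]
    refine (Con.eq c).2 ?_
    intro φ hφ k
    rw [expo_lift, expo_lift]
    have comp : ∀ u : Expo, subst φ (subst (fun i => expo (τ i)) u) =
        subst (fun i => subst φ (expo (τ i))) u := by
      intro u
      induction u using Finsupp.induction_linear with
      | zero => simp
      | add f g hf hg => simp [hf, hg]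
      | single i n => simp
    rw [comp, comp]
    refine hE e he _ (fun i => ?_) k
    have : ∀ w : Word, subst φ (expo w) ≠ 0 := by
      intro w
      induction w using FreeSemigroup.recOnMul with
      | ih1 i => simpa using hφ i
      | ih2 i w _ ih => simp [ih]
    exact this _
  have h := he c.Quotient hmod (fun i => ((FreeSemigroup.of i : Word) : c.Quotient))
  rw [lift_mk, lift_mk] at h
  have h' := (Con.eq c).1 h (fun i => Finsupp.single i 1) (by simp) 0
  simp only [expo_lift, expo_of, subst_letters, add_zero] at h'
  exact h'

theorem rel_mono {V W : ComVariety} (h : V ≤ W) {u v : Expo} (huv : W.rel u v) :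
    V.rel u v := by
  rcases huv with rfl | ⟨a, b, rfl, rfl, hab⟩
  · exact Or.inl rfl
  · exact Or.inr ⟨a, b, rfl, rfl, h hab⟩

theorem rel_sup_iff (V W : ComVariety) (u v : Expo) :
    (V ⊔ W).rel u v ↔ V.rel u v ∧ W.rel u v := by
  constructor
  · exact fun h => ⟨rel_mono le_sup_left h, rel_mono le_sup_right h⟩
  · rintro ⟨h, h'⟩
    rcases h with rfl | ⟨a, b, rfl, rfl, hab⟩
    · exact Or.inl rfl
    · exact Or.inr ⟨a, b, rfl, rfl, hab, (rel_expo_iff W a b).1 h'⟩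

/-- The congruence of a meet is contained in every equivalence relation containing
the congruences of both factors. -/
theorem rel_inf_induction {V W : ComVariety} {r : Expo → Expo → Prop} (hr : Equivalence r)
    (hV : ∀ u v, V.rel u v → r u v) (hW : ∀ u v, W.rel u v → r u v) {u v : Expo}
    (h : (V ⊓ W).rel u v) : r u v := by
  rcases h with rfl | ⟨a, b, rfl, rfl, h⟩
  · exact hr.refl _
  refine rel_of_mem_eqTh (E := V.1.th ∪ W.1.th) (e := (a, b)) hr ?_ h
  rintro e (he | he) φ hφ k
  · exact hV _ _ (V.rel_fullyInvariant.add k (V.rel_fullyInvariant.map φ hφ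
      ((rel_expo_iff V _ _).2 he)))
  · exact hW _ _ (W.rel_fullyInvariant.add k (W.rel_fullyInvariant.map φ hφ
      ((rel_expo_iff W _ _).2 he)))

theorem le_of_rel {V W : ComVariety} (h : ∀ u v, W.rel u v → V.rel u v) : V ≤ W := by
  rintro ⟨a, b⟩ hab
  exact (rel_expo_iff V a b).1 (h _ _ ((rel_expo_iff W a b).2 hab))

/-- The commutative word consisting of the single letter `t`. -/
noncomputable abbrev letter (t : ℕ) : Expo := Finsupp.single t 1

theorem letter_ne_zero (t : ℕ) : letter t ≠ 0 := by simp

theorem exists_eq_letter_add {g : Expo} {t : ℕ} (h : g t ≠ 0) : ∃ k, g = letter t + k := by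
  refine exists_add_of_le fun i => ?_
  rw [Finsupp.single_apply]
  split_ifs with hi
  · subst hi; omega
  · omega

theorem exists_eq_two_letter_add {g : Expo} {t : ℕ} (h : 2 ≤ g t) :
    ∃ k, g = 2 • letter t + k := by
  refine exists_add_of_le fun i => ?_
  rw [Finsupp.smul_apply, Finsupp.single_apply]
  split_ifs with hi
  · subst hi; simpa using h
  · simp

theorem exists_eq_two_letter_add_letter_add {g : Expo} {s t : ℕ} (hst : s ≠ t) (h : 2 ≤ g t)
    (hs : g s ≠ 0) : ∃ k, g = 2 • letter t + letter s + k := by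
  obtain ⟨k, rfl⟩ := exists_eq_two_letter_add h
  have : k s ≠ 0 := by simpa [Finsupp.single_apply, hst.symm] using hs
  obtain ⟨k', rfl⟩ := exists_eq_letter_add this
  exact ⟨k', by abel⟩

theorem subst_congr {φ : ℕ → Expo} {u : Expo} (h : ∀ i, u i ≠ 0 → φ i = letter i) :
    subst φ u = u := by
  conv_rhs => rw [← subst_letters u]
  simp only [subst, Finsupp.linearCombination_apply]
  exact Finsupp.sum_congr fun i hi => by rw [h i (by simpa using hi)]

/-- The `N`-th powers are idempotent. -/
def PowIdem (r : Expo → Expo → Prop) (N : ℕ) : Prop :=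
  ∀ a, a ≠ 0 → r (N • a) (N • a + N • a)

/-- The identity `x²y = xy²`. -/
def SquareSwap (r : Expo → Expo → Prop) : Prop :=
  ∀ a b, a ≠ 0 → b ≠ 0 → r (2 • a + b) (a + 2 • b)

/-- The identity `x²y = xᴺ⁺²y`. -/
def SquareAbsorb (r : Expo → Expo → Prop) (N : ℕ) : Prop :=
  ∀ a b, a ≠ 0 → b ≠ 0 → r (2 • a + b) (2 • a + b + N • a)

/-- The identity `xᴺ = xᴺyᴺ`, which fails exactly when semilattices are present. -/
def CollapseContent (r : Expo → Expo → Prop) (N : ℕ) : Prop :=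
  ∀ a b, a ≠ 0 → b ≠ 0 → r (N • a) (N • a + N • b)

/-- The identity `xᴺy = xᴺyᴺ⁺¹`. -/
def CollapseLinear (r : Expo → Expo → Prop) (N : ℕ) : Prop :=
  ∀ a b, a ≠ 0 → b ≠ 0 → r (N • a + b) (N • a + b + N • b)

namespace FullyInvariant

variable {r : Expo → Expo → Prop} {N : ℕ}

theorem add_left (hr : FullyInvariant r) {u v : Expo} (k : Expo) (h : r u v) :
    r (k + u) (k + v) := by
  rw [add_comm k, add_comm k]
  exact hr.add k h

/-- A two-letter identity may be evaluated at arbitrary nonempty words. -/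
theorem instantiate (hr : FullyInvariant r) {i j : ℕ} (hij : i ≠ j) {m n m' n' : ℕ}
    (h : r (m • letter i + n • letter j) (m' • letter i + n' • letter j)) {a b : Expo}
    (ha : a ≠ 0) (hb : b ≠ 0) : r (m • a + n • b) (m' • a + n' • b) := by
  have := hr.map (fun k => if k = i then a else b)
    (fun k => by by_cases hk : k = i <;> simp [hk, ha, hb]) h
  simpa [hij.symm] using this

theorem iterate (hr : FullyInvariant r) {u g : Expo} (h : r u (u + g)) (j : ℕ) :
    r u (u + j • g) := by
  induction j with
  | zero => simpa using hr.refl u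
  | succ j ih =>
    have := hr.trans ih (hr.add (j • g) h)
    convert this using 1
    module

theorem absorb_of_add_add (hr : FullyInvariant r) (hN : PowIdem r N) {u b k : Expo}
    (hb : b ≠ 0) (h : r u (u + (b + k))) : r u (u + N • b) := by
  have h1 := hr.iterate h N
  have h2 := hr.add (u + N • k) (hN _ hb)
  have h3 := hr.add (N • b) h1
  have e1 : N • b + (u + N • k) = u + N • (b + k) := by module
  have e2 : N • b + N • b + (u + N • k) = u + N • (b + k) + N • b := by module
  rw [e1, e2] at h2
  exact hr.trans h1 (hr.trans h2 (hr.symm h3))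

theorem absorb_of_add (hr : FullyInvariant r) (hN : PowIdem r N) {u g : Expo}
    (h : r u (u + g)) {t : ℕ} (ht : g t ≠ 0) : r u (u + N • letter t) := by
  obtain ⟨k, rfl⟩ := exists_eq_letter_add ht
  exact hr.absorb_of_add_add hN (letter_ne_zero t) h

/-- A word identified with a word of different content, or with a proper divisor or multiple,
absorbs the `N`-th power of one of its letters. -/
theorem exists_absorb (hr : FullyInvariant r) (hN : PowIdem r N) {u v : Expo} (h : r u v)
    (hu : u ≠ 0) (huv : u ≠ v) (hcase : (∀ i, u i = 0 ↔ v i = 0) → u ≤ v ∨ v ≤ u) :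
    ∃ t, u t ≠ 0 ∧ r u (u + N • letter t) := by
  by_cases h1 : ∃ z, u z = 0 ∧ v z ≠ 0
  · obtain ⟨z, hz, hvz⟩ := h1
    obtain ⟨k, rfl⟩ := exists_eq_letter_add hvz
    have hs := hr.map (fun i => if u i = 0 then 2 • u else letter i)
      (fun i => by by_cases hi : u i = 0 <;> simp [hi, hu]) h
    rw [subst_congr (fun i hi => by simp [hi]), map_add, subst_single] at hs
    simp only [hz, if_true] at hs
    obtain ⟨t, ht⟩ := Finsupp.ne_iff.1 hu
    refine ⟨t, ht, hr.absorb_of_add hN (g := u + subst _ k) (by convert hs using 1; module) ?_⟩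
    simpa using fun h => absurd h ht
  by_cases h2 : ∃ z, u z ≠ 0 ∧ v z = 0
  · obtain ⟨z, hz, hvz⟩ := h2
    have hs := hr.map (fun i => if i = z then 2 • letter z else letter i)
      (fun i => by by_cases hi : i = z <;> simp [hi]) h
    have hv : subst (fun i => if i = z then 2 • letter z else letter i) v = v := by
      refine subst_congr fun i hi => ?_
      have : i ≠ z := by rintro rfl; exact hi hvz
      simp [this]
    have hu' : ∀ w : Expo, subst (fun i => if i = z then 2 • letter z else letter i) w =
        w + (w z) • letter z := by
      intro w
      induction w using Finsupp.induction_linear with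
      | zero => simp
      | add f g hf hg => simp only [map_add, hf, hg, Finsupp.add_apply]; module
      | single i n =>
        by_cases hi : i = z
        · subst hi
          rw [subst_single, if_pos rfl, Finsupp.single_eq_same, ← Finsupp.smul_single_one i n]
          module
        · simp [hi]
    rw [hv, hu'] at hs
    exact ⟨z, hz, hr.absorb_of_add hN (hr.trans h (hr.symm hs)) (by simpa using hz)⟩
  push Not at h1 h2
  have hvu : ∀ i, v i ≠ 0 → u i ≠ 0 := fun i hi hi' => hi (h1 i hi')
  obtain hle | hle := hcase fun i => ⟨h1 i, fun hi => by_contra fun hi' => h2 i hi' hi⟩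
  · obtain ⟨g, rfl⟩ := exists_add_of_le hle
    have hg : g ≠ 0 := by rintro rfl; simp at huv
    obtain ⟨t, ht⟩ := Finsupp.ne_iff.1 hg
    have ht : g t ≠ 0 := ht
    exact ⟨t, hvu t (by simp [ht]), hr.absorb_of_add hN h ht⟩
  · obtain ⟨g, rfl⟩ := exists_add_of_le hle
    have hg : g ≠ 0 := by rintro rfl; simp at huv
    obtain ⟨t, ht⟩ := Finsupp.ne_iff.1 hg
    have ht : g t ≠ 0 := ht
    exact ⟨t, by simp [ht], hr.absorb_of_add hN (hr.add g (hr.symm h)) ht⟩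

/-- Incomparable words of equal content have the form `x²y⋯`. -/
theorem exists_of_incomparable {u v : Expo}
    (h : ¬ ((∀ i, u i = 0 ↔ v i = 0) → u ≤ v ∨ v ≤ u)) :
    ∃ s t, s ≠ t ∧ v t < u t ∧ u s < v s ∧ ∃ k, u = 2 • letter t + letter s + k := by
  push Not at h
  obtain ⟨hc, h1, h2⟩ := h
  rw [Finsupp.le_def] at h1 h2
  push Not at h1 h2
  obtain ⟨t, ht⟩ := h1
  obtain ⟨s, hs⟩ := h2
  have hst : s ≠ t := by rintro rfl; omega
  have := hc t
  have := hc s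
  exact ⟨s, t, hst, ht, hs,
    exists_eq_two_letter_add_letter_add hst (by omega) (by omega)⟩

end FullyInvariant

namespace FullyInvariant

variable {r : Expo → Expo → Prop} {N : ℕ}

theorem collapseLinear_of_squareSwap (hr : FullyInvariant r) (h3 : 3 ≤ N)
    (hQ : SquareSwap r) : CollapseLinear r N := by
  intro a b ha hb
  obtain ⟨M, rfl⟩ := Nat.exists_eq_add_of_le h3
  have h := hr.add (M • a) (hQ a (a + b) ha (by simp [ha]))
  refine hr.iterate ?_ _
  convert h using 1 <;> module

theorem squareSwap_absorb (hr : FullyInvariant r) (hQ : SquareSwap r) {a b c : Expo}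
    (ha : a ≠ 0) (hb : b ≠ 0) (hc : c ≠ 0) : r (2 • a + b + c) (2 • a + b + c + b) := by
  have h1 := hQ a (b + c) ha (by simp [hb])
  have h2 := hr.add (b + b) (hQ a c ha hc)
  have e1 : 2 • a + c + (b + b) = 2 • a + b + c + b := by module
  have e2 : a + 2 • c + (b + b) = a + 2 • (b + c) := by module
  rw [e1, e2] at h2
  have h3 := hr.trans h1 (hr.symm h2)
  convert h3 using 1
  module

/-- A word that is identified in `r`, but not in `q`, with another word absorbs the `N`-th
power of one of its letters. -/
theorem absorb_of_rel {q : Expo → Expo → Prop} (hq : FullyInvariant q)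
    (hr : FullyInvariant r) (hqr : ∀ u v, q u v → r u v) (hN : PowIdem q N)
    (hQD : SquareSwap q ∨ SquareAbsorb q N) {u v : Expo} (h : r u v) (hnq : ¬ q u v) :
    ∃ t, u t ≠ 0 ∧ r u (u + N • letter t) := by
  have hNr : PowIdem r N := fun a ha => hqr _ _ (hN a ha)
  have huv : u ≠ v := by rintro rfl; exact hnq (hq.refl u)
  have hu : u ≠ 0 := by
    rintro rfl
    exact huv (by_contra fun hv => hr.ne_zero (hr.symm h) (Ne.symm hv) rfl)
  by_cases hcase : (∀ i, u i = 0 ↔ v i = 0) → u ≤ v ∨ v ≤ u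
  · exact hr.exists_absorb hNr h hu huv hcase
  obtain ⟨s, t, hst, hvt, hus, k, hk⟩ := exists_of_incomparable hcase
  have hus' : u s ≠ 0 := by
    rw [hk]; simp
  have hut' : u t ≠ 0 := by omega
  rcases hQD with hQ | hD
  · have hQr : SquareSwap r := fun a b ha hb => hqr _ _ (hQ a b ha hb)
    by_cases hk0 : k = 0
    · have hc : ∀ i, u i = 0 ↔ v i = 0 := by
        by_contra hc
        exact hcase fun h => absurd h hc
      rw [hk0, add_zero] at hk
      have h1 : v t = 1 := by
        have := hc t
        have : u t = 2 := by rw [hk]; simp [hst.symm]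
        omega
      have h2 : u s = 1 := by rw [hk]; simp [hst]
      have hv : v = letter t + (v s) • letter s := by
        ext i
        by_cases hit : i = t
        · subst hit; simp [h1, hst.symm]
        by_cases his : i = s
        · subst his; simp [hst]
        have : u i = 0 := by rw [hk]; simp [hit, his]
        simp [hit, his, (hc i).1 this]
      obtain ⟨m, hm⟩ : ∃ m, v s = 2 + m := Nat.exists_eq_add_of_le (by omega)
      rcases m with _ | m
      · exfalso
        apply hnq
        rw [hk, hv, hm]
        exact hQ _ _ (letter_ne_zero t) (letter_ne_zero s)
      · have h3 := hr.add (m • letter s)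
          (hr.squareSwap_absorb hQr (letter_ne_zero s) (letter_ne_zero t) (letter_ne_zero s))
        have e1 : 2 • letter s + letter t + letter s + m • letter s = v := by
          rw [hv, hm]; module
        have e2 : 2 • letter s + letter t + letter s + letter t + m • letter s =
            v + letter t := by
          rw [hv, hm]; module
        rw [e1, e2] at h3
        exact ⟨t, hut', hr.absorb_of_add hNr
          (hr.trans (hr.trans h h3) (hr.add _ (hr.symm h))) (by simp)⟩
    · obtain ⟨z, hz⟩ := Finsupp.ne_iff.1 hk0
      obtain ⟨k', rfl⟩ := exists_eq_letter_add hz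
      have h3 := hr.add k' (hr.squareSwap_absorb hQr (letter_ne_zero t) (letter_ne_zero s)
        (letter_ne_zero z))
      refine ⟨s, hus', hr.absorb_of_add hNr (g := letter s) ?_ (by simp)⟩
      rw [hk]
      convert h3 using 1 <;> module
  · refine ⟨t, hut', ?_⟩
    have h3 := hr.add k (hqr _ _ (hD _ _ (letter_ne_zero t) (letter_ne_zero s)))
    rw [hk]
    convert h3 using 1
    module

/-- Absorption of one letter of `u` implies absorption of every letter that is repeated in `u`,
and of every letter of `u` when `u` is linear. -/
theorem absorb_letter (hr : FullyInvariant r) (hCD : CollapseLinear r N ∨ SquareAbsorb r N)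
    {u : Expo} {s t : ℕ} (hs : u s ≠ 0) (h : r u (u + N • letter s)) (ht : u t ≠ 0)
    (hut : CollapseLinear r N ∨ 2 ≤ u t ∨ ∀ i, u i ≤ 1) : r u (u + N • letter t) := by
  rcases eq_or_ne s t with rfl | hst
  · exact h
  by_cases hC : CollapseLinear r N
  · obtain ⟨k, hk⟩ := exists_eq_letter_add ht
    have h1 := hr.add k (hC _ _ (letter_ne_zero s) (letter_ne_zero t))
    have h2 := hr.add (N • letter t) h
    have e1 : N • letter s + letter t + k = u + N • letter s := by rw [hk]; module
    have e2 : N • letter s + letter t + N • letter t + k =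
      u + N • letter s + N • letter t := by rw [hk]; module
    rw [e1, e2] at h1
    exact hr.trans h (hr.trans h1 (hr.symm h2))
  rcases hut.resolve_left hC with h2 | h2
  · obtain ⟨k, hk⟩ := exists_eq_two_letter_add_letter_add hst h2 hs
    have h3 := hr.add k (hCD.resolve_left hC _ _ (letter_ne_zero t) (letter_ne_zero s))
    rw [hk]
    convert h3 using 1
    module
  · have hsw : ∀ w : Expo, ∀ i,
        subst (fun i => letter (Equiv.swap s t i)) w i = w (Equiv.swap s t i) := by
      intro w i
      induction w using Finsupp.induction_linear with
      | zero => simp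
      | add f g hf hg => simp [hf, hg]
      | single j n =>
        simp only [subst_single, Finsupp.smul_apply, Finsupp.single_apply, smul_eq_mul,
          Equiv.swap_apply_eq_iff]
        split_ifs <;> simp
    have hu : subst (fun i => letter (Equiv.swap s t i)) u = u := by
      ext i
      rw [hsw]
      rcases eq_or_ne i s with rfl | his
      · rw [Equiv.swap_apply_left]; have := h2 i; have := h2 t; omega
      rcases eq_or_ne i t with rfl | hit
      · rw [Equiv.swap_apply_right]; have := h2 i; have := h2 s; omega
      rw [Equiv.swap_apply_of_ne_of_ne his hit]
    have h3 := hr.map (fun i => letter (Equiv.swap s t i)) (by simp) h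
    simpa [hu, map_add, map_nsmul] using h3

/-- The differences of exponents in identities `xᵃ = xᵇ`. -/
def periods (hr : FullyInvariant r) : AddSubgroup ℤ where
  carrier := {k | ∃ a b : ℕ, (a : ℤ) - b = k ∧ r (a • letter 0) (b • letter 0)}
  zero_mem' := ⟨0, 0, by simp, hr.refl _⟩
  add_mem' := by
    rintro _ _ ⟨a, b, rfl, h⟩ ⟨c, d, rfl, h'⟩
    refine ⟨a + c, b + d, by push_cast; ring, ?_⟩
    rw [add_smul, add_smul]
    exact hr.trans (hr.add _ h) (hr.add_left _ h')
  neg_mem' := by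
    rintro _ ⟨a, b, rfl, h⟩
    exact ⟨b, a, by ring, hr.symm h⟩

theorem rel_of_mem_periods (hr : FullyInvariant r) (hN : PowIdem r N) (h1 : 1 ≤ N) {c d : ℕ}
    (h : (c : ℤ) - d ∈ hr.periods) {a : Expo} (ha : a ≠ 0) :
    r (c • a + N • a) (d • a + N • a) := by
  obtain ⟨m, n, hmn, h⟩ := h
  have h := hr.map (fun _ => a) (fun _ => ha) h
  simp only [map_nsmul, subst_single, one_smul] at h
  have hm : m ≤ m * N := Nat.le_mul_of_pos_right m h1
  obtain ⟨p, hp⟩ := Nat.exists_eq_add_of_le hm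
  have h2 := hr.iterate (hN a ha) m
  have h3 := hr.add ((c + p) • a + N • a) h
  have e1 : m • a + ((c + p) • a + N • a) = c • a + (N • a + m • N • a) := by
    rw [← mul_smul m N, hp]; module
  have e2 : n • a + ((c + p) • a + N • a) = d • a + (N • a + m • N • a) := by
    have hdc : n + (c + p) = d + m * N := by zify at hp ⊢; linarith
    rw [← mul_smul m N, ← add_assoc, ← add_smul, hdc]; module
  rw [e1, e2] at h3
  exact hr.trans (hr.add_left _ h2) (hr.trans h3 (hr.add_left _ (hr.symm h2)))

theorem rel_sum (hr : FullyInvariant r) {f g : ℕ → Expo} (S : Finset ℕ)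
    (h : ∀ t ∈ S, r (f t) (g t)) : r (∑ t ∈ S, f t) (∑ t ∈ S, g t) := by
  induction S using Finset.induction_on with
  | empty => exact hr.refl _
  | insert t S ht ih =>
    rw [Finset.sum_insert ht, Finset.sum_insert ht]
    exact hr.trans (hr.add _ (h t (Finset.mem_insert_self t S)))
      (hr.add_left _ (ih fun s hs => h s (Finset.mem_insert_of_mem hs)))

theorem rel_add_sum (hr : FullyInvariant r) {u : Expo} (f : ℕ → Expo) (S : Finset ℕ)
    (h : ∀ t ∈ S, r u (u + f t)) : r u (u + ∑ t ∈ S, f t) := by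
  induction S using Finset.induction_on with
  | empty => simpa using hr.refl u
  | insert t S ht ih =>
    rw [Finset.sum_insert ht, ← add_assoc]
    exact hr.trans (ih fun s hs => h s (Finset.mem_insert_of_mem hs))
      (hr.add _ (h t (Finset.mem_insert_self t S)))

/-- Words that absorb the letters in which they differ are identified as soon as their
exponents are congruent modulo the periods. -/
theorem rel_of_absorb (hr : FullyInvariant r) (hN : PowIdem r N) (h1 : 1 ≤ N) {u v : Expo}
    (hper : ∀ i, (u i : ℤ) - v i ∈ hr.periods)
    (h : ∀ t, u t = v t ∨ r u (u + N • letter t) ∧ r v (v + N • letter t)) : r u v := by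
  classical
  set S := u.support ∪ v.support with hS
  set T := S.filter (fun t => u t ≠ v t) with hT
  have hsum : ∀ w : Expo, w.support ⊆ S → w + ∑ t ∈ T, N • letter t =
      ∑ t ∈ S, (w t • letter t + if u t ≠ v t then N • letter t else 0) := by
    intro w hw
    rw [Finset.sum_add_distrib, Finset.sum_filter]
    congr 1
    conv_lhs => rw [← Finsupp.sum_single w, Finsupp.sum_of_support_subset _ hw _ (by simp)]
    simp
  have hmid : r (u + ∑ t ∈ T, N • letter t) (v + ∑ t ∈ T, N • letter t) := by
    rw [hsum u Finset.subset_union_left, hsum v Finset.subset_union_right]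
    refine hr.rel_sum S fun t _ => ?_
    by_cases ht : u t = v t
    · rw [ht]; exact hr.refl _
    · simp only [ne_eq, ht, not_false_eq_true, if_true]
      exact hr.rel_of_mem_periods hN h1 (hper t) (letter_ne_zero t)
  have hT' : ∀ t ∈ T, u t ≠ v t := fun t ht => (Finset.mem_filter.1 ht).2
  exact hr.trans (hr.rel_add_sum _ T fun t ht => ((h t).resolve_left (hT' t ht)).1)
    (hr.trans hmid
      (hr.symm (hr.rel_add_sum _ T fun t ht => ((h t).resolve_left (hT' t ht)).2)))

theorem collapseLinear_of_collapseContent (hr : FullyInvariant r)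
    (h : CollapseContent r N) : CollapseLinear r N := by
  intro a b ha hb
  have := hr.add b (h a b ha hb)
  convert this using 1
  module

/-- A sufficient condition for two words to be identified. -/
theorem rel_of_invariants (hr : FullyInvariant r) (hN : PowIdem r N) (h1 : 1 ≤ N)
    (hCD : CollapseLinear r N ∨ SquareAbsorb r N) {u v : Expo}
    (hper : ∀ i, (u i : ℤ) - v i ∈ hr.periods)
    (hcont : ∀ i, ¬ (u i = 0 ↔ v i = 0) → CollapseContent r N)
    (hlin : ∀ i, ¬ (u i = 1 ↔ v i = 1) → CollapseLinear r N)
    (hu : ∃ t, u t ≠ 0 ∧ r u (u + N • letter t))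
    (hv : ∃ t, v t ≠ 0 ∧ r v (v + N • letter t)) : r u v := by
  refine hr.rel_of_absorb hN h1 hper fun t => ?_
  by_cases hC : CollapseLinear r N
  · have key : ∀ w w' : Expo, (∀ i, ¬ (w i = 0 ↔ w' i = 0) → CollapseContent r N) →
        (∃ t, w t ≠ 0 ∧ r w (w + N • letter t)) → w t ≠ w' t → r w (w + N • letter t) := by
      rintro w w' hww ⟨s, hs, hws⟩ hne
      by_cases hwt : w t = 0
      · have hK := hww t (fun h => hne (by rw [hwt, h.1 hwt]))
        have h2 := hr.add_left w (hK _ _ (letter_ne_zero s) (letter_ne_zero t))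
        have h3 := hr.add (N • letter t) hws
        rw [← add_assoc] at h2
        exact hr.trans hws (hr.trans h2 (hr.symm h3))
      · exact hr.absorb_letter hCD hs hws hwt (Or.inl hC)
    by_cases hne : u t = v t
    · exact Or.inl hne
    · exact Or.inr ⟨key u v hcont hu hne,
        key v u (fun i hi => hcont i fun h => hi h.symm) hv (Ne.symm hne)⟩
  · have hlin' : ∀ i, u i = 1 ↔ v i = 1 := fun i => by_contra fun h => hC (hlin i h)
    have hcont' : ∀ i, u i = 0 ↔ v i = 0 := fun i =>
      by_contra fun h => hC (hr.collapseLinear_of_collapseContent (hcont i h))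
    have := hlin' t
    have := hcont' t
    by_cases hne : u t = v t
    · exact Or.inl hne
    obtain ⟨s, hs, hus⟩ := hu
    obtain ⟨s', hs', hvs⟩ := hv
    exact Or.inr ⟨hr.absorb_letter hCD hs hus (by omega) (Or.inr (Or.inl (by omega))),
      hr.absorb_letter hCD hs' hvs (by omega) (Or.inr (Or.inl (by omega)))⟩

end FullyInvariant

namespace FullyInvariant

variable {r : Expo → Expo → Prop} {N : ℕ}

theorem mem_periods_of_rel (hr : FullyInvariant r) {u v : Expo} (h : r u v) (i : ℕ) :
    (u i : ℤ) - v i ∈ hr.periods := by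
  have e1 : ∀ w : Expo, subst (fun _ => letter 0) w = w.degree • letter 0 := by
    intro w
    induction w using Finsupp.induction_linear with
    | zero => simp
    | add f g hf hg => rw [map_add, map_add, hf, hg, add_smul]
    | single j n => simp
  have e2 : ∀ w : Expo, subst (fun j => if j = i then 2 • letter 0 else letter 0) w =
      (w.degree + w i) • letter 0 := by
    intro w
    induction w using Finsupp.induction_linear with
    | zero => simp
    | add f g hf hg => rw [map_add, map_add, hf, hg, Finsupp.add_apply]; module
    | single j n =>
      rcases eq_or_ne j i with rfl | hj
      · rw [subst_single, if_pos rfl, Finsupp.single_eq_same, Finsupp.degree_single]; module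
      · simp [hj]
  have h1 := hr.map (fun _ => letter 0) (by simp) h
  have h2 := hr.map (fun j => if j = i then 2 • letter 0 else letter 0)
    (fun j => by by_cases hj : j = i <;> simp [hj]) h
  rw [e1, e1] at h1
  rw [e2, e2] at h2
  have m1 : ((u.degree : ℕ) : ℤ) - (v.degree : ℕ) ∈ hr.periods := ⟨_, _, rfl, h1⟩
  have m2 : ((u.degree + u i : ℕ) : ℤ) - (v.degree + v i : ℕ) ∈ hr.periods := ⟨_, _, rfl, h2⟩
  convert hr.periods.sub_mem m2 m1 using 1
  push_cast
  ring

theorem rel_pow_add (hr : FullyInvariant r) (hN : PowIdem r N) (h1 : 1 ≤ N) {u v : Expo}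
    (h : r u v) (i : ℕ) {a b : Expo} (ha : a ≠ 0) (hb : b ≠ 0) :
    r (N • a + u i • b) (N • a + v i • b) := by
  have e : ∀ w : Expo, ∃ m : ℕ, subst (fun j => if j = i then b else N • a) w =
      m • N • a + w i • b := by
    intro w
    induction w using Finsupp.induction_linear with
    | zero => exact ⟨0, by simp⟩
    | add f g hf hg =>
      obtain ⟨m, hm⟩ := hf
      obtain ⟨n, hn⟩ := hg
      exact ⟨m + n, by rw [map_add, hm, hn, Finsupp.add_apply]; module⟩
    | single j n =>
      rcases eq_or_ne j i with rfl | hj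
      · exact ⟨0, by simp⟩
      · exact ⟨n, by simp [hj]⟩
  have hNa : N • a ≠ 0 := by
    simp only [ne_eq, smul_eq_zero, not_or]
    exact ⟨by omega, ha⟩
  have hs := hr.map (fun j => if j = i then b else N • a)
    (fun j => by by_cases hj : j = i <;> simp only [hj, if_true, if_false, ne_eq] <;> assumption) h
  obtain ⟨m, hm⟩ := e u
  obtain ⟨n, hn⟩ := e v
  rw [hm, hn] at hs
  have hs := hr.add_left (N • a) hs
  rw [← add_assoc, ← add_assoc] at hs
  exact hr.trans (hr.add _ (hr.iterate (hN a ha) m))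
    (hr.trans hs (hr.add _ (hr.symm (hr.iterate (hN a ha) n))))

theorem collapseContent_of_rel (hr : FullyInvariant r) (hN : PowIdem r N) (h1 : 1 ≤ N)
    {u v : Expo} (h : r u v) {i : ℕ} (hi : ¬ (u i = 0 ↔ v i = 0)) : CollapseContent r N := by
  have key : ∀ {u v : Expo}, r u v → u i = 0 → v i ≠ 0 → CollapseContent r N := by
    intro u v h hu hv a b ha hb
    obtain ⟨k, hk⟩ := Nat.exists_eq_succ_of_ne_zero hv
    have h2 := hr.rel_pow_add hN h1 h i ha hb
    rw [hu, hk, zero_smul, add_zero, Nat.succ_eq_add_one, add_comm k, add_smul, one_smul] at h2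
    exact hr.absorb_of_add_add hN hb h2
  by_cases hu : u i = 0
  · exact key h hu fun hv => hi (by simp [hu, hv])
  · exact key (hr.symm h) (by_contra fun hv => hi (by simp [hu, hv])) hu

theorem collapseLinear_of_rel (hr : FullyInvariant r) (hN : PowIdem r N) (h1 : 1 ≤ N)
    {u v : Expo} (h : r u v) {i : ℕ} (hi : ¬ (u i = 1 ↔ v i = 1)) : CollapseLinear r N := by
  by_cases h0 : u i = 0 ↔ v i = 0
  swap
  · exact hr.collapseLinear_of_collapseContent (hr.collapseContent_of_rel hN h1 h h0)
  have key : ∀ {u v : Expo}, r u v → u i = 1 → 2 ≤ v i → CollapseLinear r N := by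
    intro u v h hu hv a b ha hb
    obtain ⟨k, hk⟩ := Nat.exists_eq_add_of_le hv
    have h2 := hr.rel_pow_add hN h1 h i ha hb
    rw [hu, hk, one_smul] at h2
    refine hr.absorb_of_add_add hN (k := k • b) hb ?_
    convert h2 using 1
    module
  by_cases hu : u i = 1
  · exact key h hu (by omega)
  · exact key (hr.symm h) (by omega) (by omega)

end FullyInvariant

theorem int_sup_inf_le (A B C : AddSubgroup ℤ) :
    (A ⊔ B) ⊓ (A ⊔ C) ≤ A ⊔ (B ⊓ C) := by
  obtain ⟨b, rfl⟩ := Int.subgroup_cyclic B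
  obtain ⟨c, rfl⟩ := Int.subgroup_cyclic C
  rintro k ⟨h1, h2⟩
  obtain ⟨a, ha, y, hy, rfl⟩ := AddSubgroup.mem_sup.1 h1
  obtain ⟨a', ha', z, hz, hk⟩ := AddSubgroup.mem_sup.1 h2
  obtain ⟨m, rfl⟩ := AddSubgroup.mem_closure_singleton.1 hy
  obtain ⟨n, rfl⟩ := AddSubgroup.mem_closure_singleton.1 hz
  simp only [smul_eq_mul] at *
  obtain ⟨b', hb'⟩ := Int.gcd_dvd_left b c
  obtain ⟨c', hc'⟩ := Int.gcd_dvd_right b c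
  have hbez := Int.gcd_eq_gcd_ab b c
  set g : ℤ := (Int.gcd b c : ℤ)
  set p := Int.gcdA b c
  set q := Int.gcdB b c
  by_cases hg : g = 0
  · rw [hg, zero_mul] at hb'
    rw [hb', mul_zero, add_zero]
    exact AddSubgroup.mem_sup_left ha
  have hone : b' * p + c' * q = 1 := by
    apply mul_left_cancel₀ hg
    calc g * (b' * p + c' * q) = (g * b') * p + (g * c') * q := by ring
      _ = g * 1 := by rw [← hb', ← hc', ← hbez, mul_one]
  have hbc : b' * c = c' * b := by rw [hb', hc']; ring
  have e : a + m * b = ((b' * p) * a' + (c' * q) * a) + (p * n + q * m) * (b' * c) := by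
    calc a + m * b = (b' * p) * (a + m * b) + (c' * q) * (a + m * b) := by
          rw [← add_mul, hone, one_mul]
      _ = (b' * p) * (a' + n * c) + (c' * q) * (a + m * b) := by rw [hk]
      _ = ((b' * p) * a' + (c' * q) * a) + ((p * n) * (b' * c) + (q * m) * (c' * b)) := by ring
      _ = _ := by rw [← hbc]; ring
  rw [e]
  refine add_mem (AddSubgroup.mem_sup_left (add_mem ?_ ?_)) (AddSubgroup.mem_sup_right ⟨?_, ?_⟩)
  · simpa using A.zsmul_mem ha' (b' * p)
  · simpa using A.zsmul_mem ha (c' * q)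
  · exact AddSubgroup.mem_closure_singleton.2 ⟨(p * n + q * m) * c', by rw [smul_eq_mul, hbc]; ring⟩
  · exact AddSubgroup.mem_closure_singleton.2 ⟨(p * n + q * m) * b', by rw [smul_eq_mul]; ring⟩

section Chains

variable {q α β γ θ : Expo → Expo → Prop} {N : ℕ}

/-- The transitive closure of the union of two congruences. -/
def Chain (α β : Expo → Expo → Prop) : Expo → Expo → Prop :=
  Relation.ReflTransGen fun u v => α u v ∨ β u v

theorem chain_equivalence (hα : FullyInvariant α) (hβ : FullyInvariant β) :
    Equivalence (Chain α β) where
  refl _ := Relation.ReflTransGen.refl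
  symm h := by
    have : Std.Symm fun u v => α u v ∨ β u v := ⟨fun u v h => h.imp hα.symm hβ.symm⟩
    exact Relation.ReflTransGen.stdSymm.symm _ _ h
  trans := Relation.ReflTransGen.trans

theorem Chain.mem_periods (hα : FullyInvariant α) (hβ : FullyInvariant β) {u v : Expo}
    (h : Chain α β u v) (i : ℕ) : (u i : ℤ) - v i ∈ hα.periods ⊔ hβ.periods := by
  induction h with
  | refl => simp
  | tail _ h ih =>
    rename_i w w' _
    have : (u i : ℤ) - w' i = (u i - w i) + (w i - w' i) := by ring
    rw [this]
    refine add_mem ih ?_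
    rcases h with h | h
    · exact AddSubgroup.mem_sup_left (hα.mem_periods_of_rel h i)
    · exact AddSubgroup.mem_sup_right (hβ.mem_periods_of_rel h i)

/-- A property of words that is not preserved along a chain is not preserved by one of its
links. -/
theorem Chain.exists_link {P : Expo → Prop} {X Y : Prop}
    (hX : ∀ u v, α u v → ¬ (P u ↔ P v) → X) (hY : ∀ u v, β u v → ¬ (P u ↔ P v) → Y)
    {u v : Expo} (h : Chain α β u v) (hP : ¬ (P u ↔ P v)) : X ∨ Y := by
  by_contra hXY
  rw [not_or] at hXY
  apply hP
  induction h with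
  | refl => rfl
  | tail _ h ih =>
    rename_i w w' _
    have hw : P u ↔ P w := by_contra fun hn => (hn (ih hn)).elim
    refine hw.trans (by_contra fun hn => ?_)
    exact h.elim (fun h => hXY.1 (hX _ _ h hn)) (fun h => hXY.2 (hY _ _ h hn))

theorem Chain.absorb (hq : FullyInvariant q) (hα : FullyInvariant α) (hβ : FullyInvariant β)
    (hqα : ∀ u v, q u v → α u v) (hqβ : ∀ u v, q u v → β u v) (hN : PowIdem q N)
    (hQD : SquareSwap q ∨ SquareAbsorb q N) {u v : Expo} (h : Chain α β u v)
    (huv : ¬ q u v) :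
    (∃ t, u t ≠ 0 ∧ α u (u + N • letter t)) ∨ (∃ t, u t ≠ 0 ∧ β u (u + N • letter t)) := by
  by_contra hn
  rw [not_or] at hn
  apply huv
  clear huv
  induction h with
  | refl => exact hq.refl u
  | tail _ h ih =>
    rename_i w w' _
    by_contra huw
    rcases h with h | h
    · exact hn.1 (hq.absorb_of_rel hα hqα hN hQD (hα.trans (hqα _ _ ih) h) huw)
    · exact hn.2 (hq.absorb_of_rel hβ hqβ hN hQD (hβ.trans (hqβ _ _ ih) h) huw)

/-- Distributivity for the fully invariant congruences above `q`. -/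
theorem rel_of_chains (hq : FullyInvariant q) (hα : FullyInvariant α) (hβ : FullyInvariant β)
    (hγ : FullyInvariant γ) (hθ : FullyInvariant θ) (hqα : ∀ u v, q u v → α u v)
    (hqβ : ∀ u v, q u v → β u v) (hqγ : ∀ u v, q u v → γ u v) (hαθ : ∀ u v, α u v → θ u v)
    (hβγθ : ∀ u v, β u v → γ u v → θ u v) (h3 : 3 ≤ N) (hN : PowIdem q N)
    (hQD : SquareSwap q ∨ SquareAbsorb q N) {u v : Expo} (h1 : Chain α β u v)
    (h2 : Chain α γ u v) : θ u v := by
  by_cases huv : q u v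
  · exact hαθ _ _ (hqα _ _ huv)
  have h1N : 1 ≤ N := by omega
  have idem : ∀ {r : Expo → Expo → Prop}, (∀ u v, q u v → r u v) → PowIdem r N :=
    fun hr a ha => hr _ _ (hN a ha)
  have hCDq : CollapseLinear q N ∨ SquareAbsorb q N :=
    hQD.imp_left (hq.collapseLinear_of_squareSwap h3)
  have hCD : ∀ {r : Expo → Expo → Prop}, (∀ u v, q u v → r u v) →
      CollapseLinear r N ∨ SquareAbsorb r N := fun hr =>
    hCDq.imp (fun h a b ha hb => hr _ _ (h a b ha hb)) (fun h a b ha hb => hr _ _ (h a b ha hb))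
  have hqθ : ∀ u v, q u v → θ u v := fun u v h => hαθ _ _ (hqα _ _ h)
  have habs : ∀ {u v : Expo}, Chain α β u v → Chain α γ u v → ¬ q u v →
      ∃ t, u t ≠ 0 ∧ θ u (u + N • letter t) := by
    intro u v h1 h2 huv
    rcases h1.absorb hq hα hβ hqα hqβ hN hQD huv with ⟨t, ht, h⟩ | ⟨s, hs, h⟩
    · exact ⟨t, ht, hαθ _ _ h⟩
    rcases h2.absorb hq hα hγ hqα hqγ hN hQD huv with ⟨t, ht, h'⟩ | ⟨s', hs', h'⟩
    · exact ⟨t, ht, hαθ _ _ h'⟩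
    obtain ⟨t, ht, htu⟩ : ∃ t, u t ≠ 0 ∧ (2 ≤ u t ∨ ∀ i, u i ≤ 1) := by
      by_cases hlin : ∀ i, u i ≤ 1
      · exact ⟨s, hs, Or.inr hlin⟩
      · push Not at hlin
        obtain ⟨t, ht⟩ := hlin
        exact ⟨t, by omega, Or.inl ht⟩
    exact ⟨t, ht, hβγθ _ _ (hβ.absorb_letter (hCD hqβ) hs h ht (Or.inr htu))
      (hγ.absorb_letter (hCD hqγ) hs' h' ht (Or.inr htu))⟩
  refine hθ.rel_of_invariants (idem hqθ) h1N (hCD hqθ) (fun i => ?_) (fun i hi => ?_)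
    (fun i hi => ?_) (habs h1 h2 huv)
    (habs ((chain_equivalence hα hβ).symm h1) ((chain_equivalence hα hγ).symm h2)
      fun h => huv (hq.symm h))
  · refine (?_ : hα.periods ⊔ (hβ.periods ⊓ hγ.periods) ≤ hθ.periods)
      (int_sup_inf_le _ _ _ ⟨h1.mem_periods hα hβ i, h2.mem_periods hα hγ i⟩)
    refine sup_le ?_ ?_
    · rintro _ ⟨a, b, rfl, h⟩
      exact ⟨a, b, rfl, hαθ _ _ h⟩
    · rintro _ ⟨⟨a, b, rfl, h⟩, h'⟩
      refine ⟨a + N, b + N, by push_cast; ring, ?_⟩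
      rw [add_smul, add_smul]
      exact hβγθ _ _ (hβ.add _ h) (hγ.rel_of_mem_periods (idem hqγ) h1N h' (letter_ne_zero 0))
  · rcases h1.exists_link (P := fun w => w i = 0)
      (fun _ _ h hn => hα.collapseContent_of_rel (idem hqα) h1N h hn)
      (fun _ _ h hn => hβ.collapseContent_of_rel (idem hqβ) h1N h hn) hi with hA | hB
    · exact fun a b ha hb => hαθ _ _ (hA a b ha hb)
    rcases h2.exists_link (P := fun w => w i = 0)
      (fun _ _ h hn => hα.collapseContent_of_rel (idem hqα) h1N h hn)
      (fun _ _ h hn => hγ.collapseContent_of_rel (idem hqγ) h1N h hn) hi with hA | hC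
    · exact fun a b ha hb => hαθ _ _ (hA a b ha hb)
    exact fun a b ha hb => hβγθ _ _ (hB a b ha hb) (hC a b ha hb)
  · rcases h1.exists_link (P := fun w => w i = 1)
      (fun _ _ h hn => hα.collapseLinear_of_rel (idem hqα) h1N h hn)
      (fun _ _ h hn => hβ.collapseLinear_of_rel (idem hqβ) h1N h hn) hi with hA | hB
    · exact fun a b ha hb => hαθ _ _ (hA a b ha hb)
    rcases h2.exists_link (P := fun w => w i = 1)
      (fun _ _ h hn => hα.collapseLinear_of_rel (idem hqα) h1N h hn)
      (fun _ _ h hn => hγ.collapseLinear_of_rel (idem hqγ) h1N h hn) hi with hA | hC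
    · exact fun a b ha hb => hαθ _ _ (hA a b ha hb)
    exact fun a b ha hb => hβγθ _ _ (hB a b ha hb) (hC a b ha hb)

end Chains

namespace FullyInvariant

variable {r : Expo → Expo → Prop} {N : ℕ}

theorem exists_powIdem (hr : FullyInvariant r) {u v : Expo} (h : r u v) (huv : u ≠ v) :
    ∃ N, 4 ≤ N ∧ PowIdem r N := by
  obtain ⟨i, hi⟩ := DFunLike.ne_iff.1 huv
  obtain ⟨m, n, hmn, hmn'⟩ := hr.mem_periods_of_rel h i
  have hne : m ≠ n := by
    rintro rfl
    omega
  obtain ⟨a, d, hd, had⟩ : ∃ a d : ℕ, 1 ≤ d ∧ r (a • letter 0) ((a + d) • letter 0) := by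
    rcases Nat.lt_or_gt_of_ne hne with hlt | hlt
    · exact ⟨m, n - m, by omega, by rwa [Nat.add_sub_cancel' hlt.le]⟩
    · exact ⟨n, m - n, by omega, by rw [Nat.add_sub_cancel' hlt.le]; exact hr.symm hmn'⟩
  refine ⟨4 * (a + 1) * d, by nlinarith, fun c hc => ?_⟩
  have h1 := hr.map (fun _ => c) (fun _ => hc) had
  simp only [map_nsmul, subst_single, one_smul] at h1
  rw [add_smul] at h1
  obtain ⟨p, hp⟩ : ∃ p, 4 * (a + 1) * d = a + p := Nat.exists_eq_add_of_le (by nlinarith)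
  have h2 := hr.add (p • c) (hr.iterate h1 (4 * (a + 1)))
  rw [← add_smul, ← hp] at h2
  convert h2 using 1
  rw [add_right_comm (a • c), ← add_smul a p, ← hp, ← mul_smul (4 * (a + 1)) d]

theorem squareAbsorb_of_absorb (hr : FullyInvariant r) {i j t : ℕ} (hij : i ≠ j)
    (h1 : 1 ≤ N) (ht : (2 • letter i + letter j) t ≠ 0)
    (h : r (2 • letter i + letter j) (2 • letter i + letter j + N • letter t)) :
    SquareAbsorb r N := by
  intro a b ha hb
  obtain rfl | rfl : t = i ∨ t = j := by
    by_contra hn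
    rw [not_or] at hn
    exact ht (by simp [Ne.symm hn.1, Ne.symm hn.2])
  · have h2 := hr.instantiate hij (m := 2) (n := 1) (m' := N + 2) (n' := 1)
      (by convert h using 1 <;> module) ha hb
    convert h2 using 1 <;> module
  · have h2 : ∀ {a b : Expo}, a ≠ 0 → b ≠ 0 → r (2 • a + 1 • b) (2 • a + (N + 1) • b) :=
      hr.instantiate hij (by convert h using 1 <;> module)
    obtain ⟨M, rfl⟩ := Nat.exists_eq_add_of_le h1
    have h3 := hr.add (a + M • b) (h2 hb ha)
    have h4 := hr.add ((1 + M) • a) (h2 ha hb)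
    have e1 : 2 • b + 1 • a + (a + M • b) = 2 • a + (1 + M + 1) • b := by module
    have e2 : 2 • b + (1 + M + 1) • a + (a + M • b) =
      2 • a + (1 + M + 1) • b + (1 + M) • a := by module
    rw [e1, e2] at h3
    have h5 := hr.trans (h2 ha hb) (hr.trans h3 (hr.symm h4))
    rwa [one_smul] at h5

/-- If neither `x²y = xy²` nor `x²y = xᴺ⁺²y` holds, then `x²y` is an isoterm. -/
theorem eq_of_rel_two_letter_add (hr : FullyInvariant r) (hN : PowIdem r N) (h1 : 1 ≤ N)
    (hQ : ¬ SquareSwap r) (hD : ¬ SquareAbsorb r N) {i j : ℕ} (hij : i ≠ j) {w : Expo}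
    (h : r (2 • letter i + letter j) w) : 2 • letter i + letter j = w := by
  have key : ∀ {w : Expo}, r (2 • letter i + letter j) w → 2 • letter i + letter j ≠ w →
      ¬ ((∀ t, (2 • letter i + letter j) t = 0 ↔ w t = 0) →
        2 • letter i + letter j ≤ w ∨ w ≤ 2 • letter i + letter j) := by
    intro w h hne hcase
    obtain ⟨t, ht, ha⟩ := hr.exists_absorb hN h (by simp) hne hcase
    exact hD (hr.squareAbsorb_of_absorb hij h1 ht ha)
  by_contra hne
  have hk := key h hne
  have hc : ∀ t, (2 • letter i + letter j) t = 0 ↔ w t = 0 := by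
    by_contra hc
    exact hk fun h => (hc h).elim
  obtain ⟨s, t, hst, hwt, hws, -⟩ := exists_of_incomparable hk
  have hi := hc i
  have hj := hc j
  have vi : (2 • letter i + letter j) i = 2 := by simp [hij]
  have vj : (2 • letter i + letter j) j = 1 := by simp [hij]
  have vo : ∀ l, l ≠ i → l ≠ j → (2 • letter i + letter j) l = 0 := by
    intro l h1 h2
    simp [h1, h2]
  have hti : t = i := by
    by_contra hti
    by_cases htj : t = j
    · subst htj; omega
    · rw [vo t hti htj] at hwt; omega
  subst hti
  have hsj : s = j := by
    by_contra hsj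
    have := hc s
    rw [vo s hst hsj] at this hws
    omega
  subst hsj
  have hw : w = 1 • letter t + w s • letter s := by
    ext l
    rcases eq_or_ne l t with rfl | hlt
    · simp [hst]; omega
    rcases eq_or_ne l s with rfl | hls
    · simp [hst]
    · have := hc l
      rw [vo l hlt hls] at this
      simp [hlt, hls]; omega
  obtain ⟨b, hb⟩ : ∃ b, w s = b + 2 := Nat.exists_eq_add_of_le' (by omega)
  rw [hb] at hw
  have h2 : ∀ {a b' : Expo}, a ≠ 0 → b' ≠ 0 → r (2 • a + 1 • b') (1 • a + (b + 2) • b') :=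
    hr.instantiate hij (by rw [one_smul, ← hw]; exact h)
  rcases Nat.eq_zero_or_pos b with rfl | hb0
  · exact hQ fun a b ha hb => by simpa using h2 ha hb
  have h3 := hr.add (b • letter s) (h2 (letter_ne_zero s) (letter_ne_zero t))
  have e1 : 2 • letter s + 1 • letter t + b • letter s = w := by rw [hw]; module
  have e2 : 1 • letter s + (b + 2) • letter t + b • letter s =
      2 • letter t + letter s + (b • letter t + b • letter s) := by module
  rw [e1, e2] at h3
  refine key (hr.trans h h3) ?_ fun _ => Or.inl le_self_add
  intro he
  have := DFunLike.congr_fun he t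
  simp [hij] at this
  omega

end FullyInvariant

/-- Exponent vectors of words of the form `x²y`. -/
def IsSquareLetter (w : Expo) : Prop :=
  ∃ i j, i ≠ j ∧ w = 2 • letter i + letter j

theorem IsSquareLetter.le_two {w : Expo} (h : IsSquareLetter w) (t : ℕ) : w t ≤ 2 := by
  obtain ⟨i, j, hij, rfl⟩ := h
  simp only [Finsupp.add_apply, Finsupp.smul_apply, Finsupp.single_apply, smul_eq_mul]
  split_ifs <;> omega

/-- If `a²bk` has the form `x²y`, then so does `ab²k`. -/
theorem IsSquareLetter.swap {a b k : Expo} (ha : a ≠ 0) (hb : b ≠ 0)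
    (h : IsSquareLetter (2 • a + b + k)) : IsSquareLetter (a + 2 • b + k) := by
  obtain ⟨i, j, hij, h⟩ := h
  have hv : ∀ t, 2 * a t + b t + k t = (2 • letter i + letter j) t := fun t => by
    rw [← h]; simp
  have vi := hv i
  have vj := hv j
  have vo : ∀ t, t ≠ i → t ≠ j → 2 * a t + b t + k t = 0 := fun t h1 h2 => by
    rw [hv]; simp [h1, h2]
  simp [hij, hij.symm] at vi vj
  obtain ⟨s, hs⟩ := DFunLike.ne_iff.1 ha
  obtain ⟨t, ht⟩ := DFunLike.ne_iff.1 hb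
  simp only [Finsupp.coe_zero, Pi.zero_apply] at hs ht
  have hsi : s = i := by
    by_contra hsi
    by_cases hsj : s = j
    · subst hsj; omega
    · have := vo s hsi hsj; omega
  subst hsi
  have htj : t = j := by
    by_contra htj
    by_cases hts : t = s
    · subst hts; omega
    · have := vo t hts htj; omega
  subst htj
  refine ⟨t, s, hij.symm, ?_⟩
  ext l
  rcases eq_or_ne l s with rfl | hls
  · simp [hij]; omega
  rcases eq_or_ne l t with rfl | hlt
  · simp [hij]; omega
  · have := vo l hls hlt
    simp [hls, hlt]; omega

theorem expo_w_xxy : expo w_xxy = 2 • letter 0 + letter 1 := by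
  simp only [w_xxy, xw, yw, expo_mul, expo_of]
  module

theorem expo_w_xyy : expo w_xyy = letter 0 + 2 • letter 1 := by
  simp only [w_xyy, xw, yw, expo_mul, expo_of]
  module

theorem ComVariety.squareSwap_or_squareAbsorb {V : ComVariety} (h : IsUpperModular V) {N : ℕ}
    (h4 : 4 ≤ N) (hN : PowIdem V.rel N) : SquareSwap V.rel ∨ SquareAbsorb V.rel N := by
  by_contra hQD
  rw [not_or] at hQD
  have hV := V.rel_fullyInvariant
  have iso : ∀ u v, V.rel u v → IsSquareLetter u → u = v := by
    rintro u v huv ⟨i, j, hij, rfl⟩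
    exact hV.eq_of_rel_two_letter_add hN (by omega) hQD.1 hQD.2 hij huv
  obtain ⟨p, hp⟩ := exists_expo_eq (u := (2 * N) • letter 0 + N • letter 1) (by
    intro h0
    have := DFunLike.congr_fun h0 0
    simp at this
    omega)
  let B : ComVariety := ⟨varOf (V.1.th ∪ {idQ}), subset_eqTh _ (Or.inl V.2)⟩
  let C : ComVariety := ⟨varOf {commId, (w_xxy, p)}, subset_eqTh _ (Or.inl rfl)⟩
  have hBV : B ≤ V := fun e he => subset_eqTh _ (Or.inl he)
  have hBQ : B.rel (2 • letter 0 + letter 1) (letter 0 + 2 • letter 1) := by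
    rw [← expo_w_xxy, ← expo_w_xyy, rel_expo_iff]
    exact subset_eqTh _ (Or.inr rfl)
  have hCp : C.rel (2 • letter 0 + 1 • letter 1) ((2 * N) • letter 0 + N • letter 1) := by
    rw [one_smul, ← expo_w_xxy, ← hp, rel_expo_iff]
    exact subset_eqTh _ (Or.inr rfl)
  have hC' := C.rel_fullyInvariant.instantiate zero_ne_one hCp (letter_ne_zero 1)
    (letter_ne_zero 0)
  have hBV' : ∀ u v, B.rel u v → (IsSquareLetter u ↔ IsSquareLetter v) := by
    rintro u v (rfl | ⟨a, b, rfl, rfl, hab⟩)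
    · rfl
    refine rel_of_mem_eqTh (r := fun u v => IsSquareLetter u ↔ IsSquareLetter v)
      ⟨fun _ => Iff.rfl, Iff.symm, Iff.trans⟩ ?_ hab
    rintro ⟨c, d⟩ (he | he) φ hφ k
    · have hcd := hV.add k (hV.map φ hφ ((rel_expo_iff V c d).2 he))
      constructor
      · intro hl
        rwa [← iso _ _ hcd hl]
      · intro hl
        rwa [← iso _ _ (hV.symm hcd) hl]
    · obtain ⟨rfl, rfl⟩ := Prod.mk.inj he
      rw [expo_w_xxy, expo_w_xyy]
      simp only [map_add, map_nsmul, subst_single, one_smul]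
      refine ⟨IsSquareLetter.swap (hφ 0) (hφ 1), fun hl => ?_⟩
      rw [add_comm (φ 0)] at hl
      rw [add_comm (2 • φ 0)]
      exact IsSquareLetter.swap (hφ 1) (hφ 0) hl
  have hCmod : ∀ u v, C.rel u v → ∀ i, u i ≡ v i [MOD (N - 1)] := by
    rintro u v (rfl | ⟨a, b, rfl, rfl, hab⟩)
    · exact fun _ => rfl
    refine rel_of_mem_eqTh (r := fun u v => ∀ i, u i ≡ v i [MOD (N - 1)])
      ⟨fun _ _ => rfl, fun h i => (h i).symm, fun h h' i => (h i).trans (h' i)⟩ ?_ hab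
    rintro ⟨c, d⟩ (he | he) φ hφ k i
    · obtain ⟨rfl, rfl⟩ := Prod.mk.inj he
      simp only [expo_mul, add_comm]
      rfl
    · obtain ⟨rfl, rfl⟩ := Prod.mk.inj he
      simp only [expo_w_xxy, hp, map_add, map_nsmul, subst_single, one_smul,
        Finsupp.add_apply, Finsupp.smul_apply, smul_eq_mul]
      have hN1 : 1 ≡ N [MOD (N - 1)] := (Nat.modEq_iff_dvd' (by omega)).2 dvd_rfl
      refine Nat.ModEq.add_right _ (Nat.ModEq.add ?_ ?_)
      · simpa using (hN1.mul_left 2).mul_right (φ 0 i)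
      · simpa using hN1.mul_right (φ 1 i)
  have hrel : (V ⊓ (B ⊔ C)).rel (2 • letter 0 + letter 1) (letter 0 + 2 • letter 1) := by
    rw [h B C hBV, rel_sup_iff]
    refine ⟨hBQ, ?_⟩
    have hI := (V ⊓ C).rel_fullyInvariant
    have hNI : PowIdem (V ⊓ C).rel N := fun a ha => rel_mono inf_le_left (hN a ha)
    have s1 := rel_mono (inf_le_right : V ⊓ C ≤ C) hCp
    have s2 := hI.add (N • letter 1) (hI.symm (hNI _ (letter_ne_zero 0)))
    have s3 := hI.add (N • letter 0) (hNI _ (letter_ne_zero 1))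
    have s4 := hI.symm (rel_mono (inf_le_right : V ⊓ C ≤ C) hC')
    have e1 : N • letter 0 + N • letter 0 + N • letter 1 =
      (2 * N) • letter 0 + N • letter 1 := by module
    have e2 : N • letter 1 + N • letter 1 + N • letter 0 =
      (2 * N) • letter 1 + N • letter 0 := by module
    rw [e1] at s2
    rw [e2, add_comm (N • letter 1)] at s3
    have := hI.trans s1 (hI.trans s2 (hI.trans s3 s4))
    rw [one_smul, one_smul] at this
    rwa [add_comm (letter 0)]
  have hfin := rel_inf_induction
    (r := fun u v => IsSquareLetter u ∨ IsSquareLetter v → u = v)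
    ⟨fun _ _ => rfl, fun h h' => (h h'.symm).symm, fun {u v w} h1 h2 h' => by
      rcases h' with h' | h'
      · obtain rfl := h1 (Or.inl h')
        exact h2 (Or.inl h')
      · obtain rfl := h2 (Or.inr h')
        exact h1 (Or.inr h')⟩
    (fun u v huv hl => hl.elim (iso u v huv) fun hl => (iso v u (hV.symm huv) hl).symm)
    (fun u v huv hl => by
      obtain ⟨hb, hc⟩ := (rel_sup_iff _ _ _ _).1 huv
      have hb := hBV' u v hb
      have hu : IsSquareLetter u := hl.elim id hb.2
      ext t
      have h1 := hu.le_two t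
      have h2 := (hb.1 hu).le_two t
      exact (hCmod u v hc t).eq_of_lt_of_lt (by omega) (by omega))
    hrel (Or.inl ⟨0, 1, zero_ne_one, rfl⟩)
  have := DFunLike.congr_fun hfin 0
  simp at this

theorem ComVariety.exists_rel_ne {V : ComVariety} (hV : V ≠ COMcom) :
    ∃ u v, V.rel u v ∧ u ≠ v := by
  by_contra hn
  push Not at hn
  refine hV (le_antisymm ?_ (le_of_rel fun u v huv => ?_))
  · exact (eqTh_mono (Set.singleton_subset_iff.2 V.2)).trans V.1.closed.subset
  · rw [hn u v huv]
    exact COMcom.rel_fullyInvariant.refl v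

/-- If a commutative semigroup variety `V ≠ COM` is an
upper-modular element of **Com**, then the lattice `L(V)` of subvarieties of
`V` is distributive. -/
theorem upperModular_implies_distributive_subvariety_lattice (V : ComVariety)
    (hV : V ≠ COMcom) (h : IsUpperModular V) :
    ∀ A B C : ComVariety, A ≤ V → B ≤ V → C ≤ V →
      A ⊓ (B ⊔ C) = (A ⊓ B) ⊔ (A ⊓ C) := by
  obtain ⟨u, v, huv, hne⟩ := ComVariety.exists_rel_ne hV
  have hq := V.rel_fullyInvariant
  obtain ⟨N, h4, hN⟩ := hq.exists_powIdem huv hne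
  have hQD := ComVariety.squareSwap_or_squareAbsorb h h4 hN
  intro A B C hA hB hC
  refine le_antisymm (le_of_rel fun u v huv => ?_) le_inf_sup
  rw [rel_sup_iff] at huv
  have chain : ∀ W : ComVariety, (A ⊓ W).rel u v → Chain A.rel W.rel u v := fun W hW =>
    rel_inf_induction (chain_equivalence A.rel_fullyInvariant W.rel_fullyInvariant)
      (fun _ _ h => Relation.ReflTransGen.single (Or.inl h))
      (fun _ _ h => Relation.ReflTransGen.single (Or.inr h)) hW
  exact rel_of_chains hq A.rel_fullyInvariant B.rel_fullyInvariant C.rel_fullyInvariant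
    (A ⊓ (B ⊔ C)).rel_fullyInvariant (fun _ _ => rel_mono hA) (fun _ _ => rel_mono hB)
    (fun _ _ => rel_mono hC) (fun _ _ => rel_mono inf_le_left)
    (fun _ _ h h' => rel_mono inf_le_right ((rel_sup_iff _ _ _ _).2 ⟨h, h'⟩)) (by omega) hN hQD
    (chain B huv.1) (chain C huv.2)
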